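/- Let (Ω, μ) be a measure space and let 𝒯 be a finite collection of pairwise disjoint measurable subsets of Ω whose union is Ω. Let F : Ω → ℝ^{3×2} be measurable with square-integrable entries and g : Ω → ℝ^{2×2} measurable with integrable entries. If Σ_{T ∈ 𝒯} ‖∫_T (Fᵀ F − g) dμ‖_F ≤ ε for some ε ≥ 0, then ∫_Ω ‖F‖_F² dμ ≤ √2 · (ε + ∫_Ω ‖g‖_F dμ). -/

import Mathlib

open MeasureTheory Matrix

/-- The square of the Frobenius norm of a real matrix. -/
noncomputable def frobNormSq {m n : Type*} [Fintype m] [Fintype n]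
    (A : Matrix m n ℝ) : ℝ :=
  ∑ i, ∑ j, (A i j) ^ 2

/-- The Frobenius norm of a real matrix. -/
noncomputable def frobNorm {m n : Type*} [Fintype m] [Fintype n]
    (A : Matrix m n ℝ) : ℝ :=
  Real.sqrt (frobNormSq A)

theorem trace_le_sqrt_card_mul_frobNorm {n : Type*} [Fintype n] (A : Matrix n n ℝ) :
    A.trace ≤ Real.sqrt (Fintype.card n) * frobNorm A := by
  rw [frobNorm, ← Real.sqrt_mul (Nat.cast_nonneg _)]
  refine Real.le_sqrt_of_sq_le ?_
  calc A.trace ^ 2 ≤ Fintype.card n * ∑ i, A i i ^ 2 := sq_sum_le_card_mul_sum_sq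
    _ ≤ Fintype.card n * frobNormSq A := by
      refine mul_le_mul_of_nonneg_left (Finset.sum_le_sum fun i _ => ?_) (Nat.cast_nonneg _)
      exact Finset.single_le_sum (f := fun j => A i j ^ 2) (fun j _ => sq_nonneg _)
        (Finset.mem_univ i)

theorem frobNorm_le_sum_abs {m n : Type*} [Fintype m] [Fintype n] (A : Matrix m n ℝ) :
    frobNorm A ≤ ∑ i, ∑ j, |A i j| := by
  refine Real.sqrt_le_iff.2 ⟨by positivity, ?_⟩
  rw [frobNormSq, ← Fintype.sum_prod_type', ← Fintype.sum_prod_type']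
  simpa using Finset.sum_sq_le_sq_sum_of_nonneg (s := Finset.univ)
    (f := fun p : m × n => |A p.1 p.2|) fun p _ => abs_nonneg _

theorem frobNormSq_eq_trace {m n : Type*} [Fintype m] [Fintype n] (A : Matrix m n ℝ) :
    frobNormSq A = (Aᵀ * A).trace := by
  simp only [frobNormSq, trace, diag_apply, mul_apply, transpose_apply, sq]
  exact Finset.sum_comm

section Integrability

variable {Ω m n : Type*} [MeasurableSpace Ω] {μ : Measure Ω} [Fintype m]

theorem integrable_transpose_mul_self_apply {F : Ω → Matrix m n ℝ}
    (hF : ∀ i j, MemLp (fun x => F x i j) 2 μ) (k l : n) :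
    Integrable (fun x => ((F x)ᵀ * F x) k l) μ :=
  integrable_finsetSum _ fun i _ => (hF i k).integrable_mul (hF i l)

variable [Fintype n]

theorem integrable_frobNorm {g : Ω → Matrix m n ℝ}
    (hg : ∀ i j, Integrable (fun x => g x i j) μ) :
    Integrable (fun x => frobNorm (g x)) μ := by
  refine Integrable.mono' (g := fun x => ∑ i, ∑ j, |g x i j|)
    (integrable_finsetSum _ fun i _ => integrable_finsetSum _ fun j _ => (hg i j).abs) ?_ ?_
  · refine Real.continuous_sqrt.comp_aestronglyMeasurable ?_
    exact Finset.aestronglyMeasurable_fun_sum _ fun i _ =>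
      Finset.aestronglyMeasurable_fun_sum _ fun j _ => (hg i j).aestronglyMeasurable.pow 2
  · refine .of_forall fun x => ?_
    exact (Real.norm_of_nonneg (Real.sqrt_nonneg _)).trans_le (frobNorm_le_sum_abs (g x))

theorem integrable_frobNormSq {F : Ω → Matrix m n ℝ}
    (hF : ∀ i j, Integrable (fun x => F x i j ^ 2) μ) :
    Integrable (fun x => frobNormSq (F x)) μ :=
  integrable_finsetSum _ fun i _ => integrable_finsetSum _ fun j _ => hF i j

/-- On a single domain, the gradient energy is controlled by the metric defect
and the size of the metric. -/
theorem integral_frobNormSq_le {F : Ω → Matrix m n ℝ} {g : Ω → Matrix n n ℝ}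
    (hF : ∀ i j, MemLp (fun x => F x i j) 2 μ)
    (hg : ∀ i j, Integrable (fun x => g x i j) μ) :
    ∫ x, frobNormSq (F x) ∂μ ≤ Real.sqrt (Fintype.card n) *
      (frobNorm (Matrix.of fun k l => ∫ x, ((F x)ᵀ * F x - g x) k l ∂μ) +
        ∫ x, frobNorm (g x) ∂μ) := by
  have hD : ∀ k l, Integrable (fun x => ((F x)ᵀ * F x - g x) k l) μ := fun k l =>
    (integrable_transpose_mul_self_apply hF k l).sub (hg k l)
  have htr : Integrable (fun x => (g x).trace) μ := integrable_finsetSum _ fun k _ => hg k k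
  have hDtr : Integrable (fun x => ((F x)ᵀ * F x - g x).trace) μ :=
    integrable_finsetSum _ fun k _ => hD k k
  have hsplit : ∫ x, frobNormSq (F x) ∂μ =
      (Matrix.of fun k l => ∫ x, ((F x)ᵀ * F x - g x) k l ∂μ).trace + ∫ x, (g x).trace ∂μ := by
    have htrace : (Matrix.of fun k l => ∫ x, ((F x)ᵀ * F x - g x) k l ∂μ).trace =
        ∫ x, ((F x)ᵀ * F x - g x).trace ∂μ :=
      (integral_finsetSum _ fun k _ => hD k k).symm
    rw [htrace, ← integral_add hDtr htr]
    simp [frobNormSq_eq_trace, trace_sub]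
  rw [hsplit, mul_add, ← integral_const_mul]
  exact add_le_add (trace_le_sqrt_card_mul_frobNorm _)
    (integral_mono htr ((integrable_frobNorm hg).const_mul _) fun x =>
      trace_le_sqrt_card_mul_frobNorm _)

end Integrability

/-- Lemma 3.3 (gradient estimate): if the metric defect of `F` relative to `g`,
over a finite measurable partition `T` of `Ω`, is at most `ε`, then
`∫ ‖F‖_F² ≤ √2 (ε + ∫ ‖g‖_F)`. -/
theorem stmt_3 {Ω : Type*} [MeasurableSpace Ω] (μ : Measure Ω)
    {ι : Type*} [Fintype ι] (T : ι → Set Ω)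
    (hTmeas : ∀ i, MeasurableSet (T i))
    (hTdisj : Pairwise (Function.onFun Disjoint T))
    (hTcover : (⋃ i, T i) = Set.univ)
    (F : Ω → Matrix (Fin 3) (Fin 2) ℝ)
    (hFmeas : ∀ i j, Measurable fun x => F x i j)
    (hFsq : ∀ i j, Integrable (fun x => (F x i j) ^ 2) μ)
    (g : Ω → Matrix (Fin 2) (Fin 2) ℝ)
    (hgmeas : ∀ i j, Measurable fun x => g x i j)
    (hgint : ∀ i j, Integrable (fun x => g x i j) μ)
    (ε : ℝ) (hε : 0 ≤ ε)
    (hdef : ∑ i, frobNorm (Matrix.of (fun k l => ∫ x in T i, ((F x)ᵀ * F x - g x) k l ∂μ)) ≤ ε) :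
    ∫ x, frobNormSq (F x) ∂μ ≤ Real.sqrt 2 * (ε + ∫ x, frobNorm (g x) ∂μ) := by
  have hsum : ∀ f : Ω → ℝ, Integrable f μ → ∫ x, f x ∂μ = ∑ i, ∫ x in T i, f x ∂μ := by
    intro f hf
    rw [← setIntegral_univ, ← hTcover,
      integral_iUnion_fintype hTmeas hTdisj fun i => hf.integrableOn]
  have hF : ∀ i j, MemLp (fun x => F x i j) 2 μ := fun i j =>
    (memLp_two_iff_integrable_sq (hFmeas i j).aestronglyMeasurable).2 (hFsq i j)
  rw [hsum _ (integrable_frobNormSq hFsq), hsum _ (integrable_frobNorm hgint)]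
  calc ∑ i, ∫ x in T i, frobNormSq (F x) ∂μ
      ≤ ∑ i, Real.sqrt 2 *
          (frobNorm (Matrix.of fun k l => ∫ x in T i, ((F x)ᵀ * F x - g x) k l ∂μ) +
            ∫ x in T i, frobNorm (g x) ∂μ) :=
        Finset.sum_le_sum fun i _ => by
          simpa using integral_frobNormSq_le (μ := μ.restrict (T i))
            (fun k l => (hF k l).restrict _) (fun k l => (hgint k l).restrict)
    _ ≤ Real.sqrt 2 * (ε + ∑ i, ∫ x in T i, frobNorm (g x) ∂μ) := by
        rw [← Finset.mul_sum, Finset.sum_add_distrib]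
        gcongr
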